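/- For every digit rewriting system with associated category F and every finite word w over its alphabet, the fundamental group Π(F, w) is bi-orderable. -/

import Mathlib

open CategoryTheory

universe v u

namespace OreOrder

/-- A group is bi-orderable if it admits a linear order invariant under left and right
multiplication. -/
def IsBiOrderable (G : Type*) [Group G] : Prop :=
  ∃ lt : G → G → Prop,
    (∀ a, ¬ lt a a) ∧ (∀ a b c, lt a b → lt b c → lt a c) ∧
    (∀ a b, a ≠ b → lt a b ∨ lt b a) ∧
    (∀ a b c, lt b c → lt (a * b) (a * c)) ∧
    (∀ a b c, lt b c → lt (b * a) (c * a))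

/-- A category is right-Ore if it is cancellative and has common right multiples. -/
structure IsRightOre (C : Type u) [Category.{v} C] : Prop where
  cancel_left : ∀ {x y z : C} (a : x ⟶ y) (b c : y ⟶ z), a ≫ b = a ≫ c → b = c
  cancel_right : ∀ {x y z : C} (a b : x ⟶ y) (c : y ⟶ z), a ≫ c = b ≫ c → a = b
  common_right_mul : ∀ {x y₁ y₂ : C} (a₁ : x ⟶ y₁) (a₂ : x ⟶ y₂),
    ∃ (z : C) (b₁ : y₁ ⟶ z) (b₂ : y₂ ⟶ z), a₁ ≫ b₁ = a₂ ≫ b₂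

/-- The fundamental group of a category `C` based at an object `ε`: the vertex group at `ε`
of the enveloping groupoid of `C`, i.e. of the localization of `C` at all of its morphisms. -/
abbrev FundGroup (C : Type u) [Category.{v} C] (ε : C) :=
  Aut ((⊤ : MorphismProperty C).Q.obj ε)

/-- A digit rewriting system (DRS) over an alphabet `A`: a set of rewriting rules
`x ← u₁ ⋯ u_k` (`k ≥ 2`), with at most one rule for each letter `x`. -/
structure DRS (A : Type u) where
  rule : A → Option (List A)
  two_le_length : ∀ x u, rule x = some u → 2 ≤ u.length

/-- The objects of the category of a DRS: the finite words over the alphabet. -/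
structure DRSObj {A : Type u} (R : DRS A) where
  word : List A

/-- The elementary rewritings `w₁ x w₂ ← w₁ u₁ ⋯ u_k w₂` of a DRS. -/
inductive DRSEdge {A : Type u} (R : DRS A) : List A → List A → Type u
  | rewrite (w₁ w₂ : List A) (x : A) (u : List A) (hu : R.rule x = some u)
      {a b : List A} (ha : a = w₁ ++ x :: w₂) (hb : b = w₁ ++ u ++ w₂) : DRSEdge R a b

instance {A : Type u} (R : DRS A) : Quiver (DRSObj R) :=
  ⟨fun v w => DRSEdge R v.word w.word⟩

/-- A single elementary rewriting, as a morphism of the path category. -/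
def singleRewrite {A : Type u} (R : DRS A) (w₁ w₂ : List A) (x : A) (u : List A)
    (hu : R.rule x = some u) (a b : List A)
    (ha : a = w₁ ++ x :: w₂) (hb : b = w₁ ++ u ++ w₂) :
    Quiver.Path (⟨a⟩ : DRSObj R) (⟨b⟩ : DRSObj R) :=
  Quiver.Hom.toPath
    (show (⟨a⟩ : DRSObj R) ⟶ (⟨b⟩ : DRSObj R) from DRSEdge.rewrite w₁ w₂ x u hu ha hb)

/-- The relations of the category of a DRS: two rewritings performed on disjoint subwords
commute. -/
inductive DRSRel {A : Type u} (R : DRS A) : HomRel (Paths (DRSObj R))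
  | comm (w₁ w₂ w₃ : List A) (x₁ x₂ : A) (u₁ u₂ : List A)
      (h₁ : R.rule x₁ = some u₁) (h₂ : R.rule x₂ = some u₂) :
      DRSRel R
        (singleRewrite R w₁ (w₂ ++ x₂ :: w₃) x₁ u₁ h₁
            (w₁ ++ x₁ :: (w₂ ++ x₂ :: w₃)) (w₁ ++ u₁ ++ (w₂ ++ x₂ :: w₃)) rfl rfl |>.comp <|
          singleRewrite R (w₁ ++ u₁ ++ w₂) w₃ x₂ u₂ h₂
            (w₁ ++ u₁ ++ (w₂ ++ x₂ :: w₃)) (w₁ ++ u₁ ++ (w₂ ++ u₂ ++ w₃))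
            (by simp) (by simp))
        (singleRewrite R (w₁ ++ x₁ :: w₂) w₃ x₂ u₂ h₂
            (w₁ ++ x₁ :: (w₂ ++ x₂ :: w₃)) (w₁ ++ x₁ :: (w₂ ++ u₂ ++ w₃))
            (by simp) (by simp) |>.comp <|
          singleRewrite R w₁ (w₂ ++ u₂ ++ w₃) x₁ u₁ h₁
            (w₁ ++ x₁ :: (w₂ ++ u₂ ++ w₃)) (w₁ ++ u₁ ++ (w₂ ++ u₂ ++ w₃)) rfl rfl)

/-- The category `F` associated to a digit rewriting system `R`. -/
abbrev DRSCat {A : Type u} (R : DRS A) := CategoryTheory.Quotient (DRSRel R)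

/-- The object of `DRSCat R` corresponding to a word `w`. -/
abbrev DRSCat.ofWord {A : Type u} (R : DRS A) (w : List A) : DRSCat R := ⟨⟨w⟩⟩


section General

variable {C : Type u} [Category.{v} C]

/-- An Ore category with bi-invariant orders on its hom-sets has bi-orderable fundamental groups. -/
theorem biOrderable_of_order
    (lt : ∀ {X Y : C}, (X ⟶ Y) → (X ⟶ Y) → Prop)
    (irr : ∀ {X Y : C} (a : X ⟶ Y), ¬ lt a a)
    (tra : ∀ {X Y : C} (a b c : X ⟶ Y), lt a b → lt b c → lt a c)
    (tot : ∀ {X Y : C} (a b : X ⟶ Y), a ≠ b → lt a b ∨ lt b a)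
    (post : ∀ {X Y Z : C} (a b : X ⟶ Y) (c : Y ⟶ Z), lt a b → lt (a ≫ c) (b ≫ c))
    (pre : ∀ {X Y Z : C} (c : X ⟶ Y) (a b : Y ⟶ Z), lt a b → lt (c ≫ a) (c ≫ b))
    (ore : ∀ {x y₁ y₂ : C} (a₁ : x ⟶ y₁) (a₂ : x ⟶ y₂),
      ∃ (z : C) (b₁ : y₁ ⟶ z) (b₂ : y₂ ⟶ z), a₁ ≫ b₁ = a₂ ≫ b₂)
    (w : C) : IsBiOrderable (FundGroup C w) := by
  have canL : ∀ {x y z : C} (a : x ⟶ y) (b c : y ⟶ z), a ≫ b = a ≫ c → b = c := by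
    intro x y z a b c h
    by_contra hne
    rcases tot b c hne with h1 | h1
    · have := pre a _ _ h1
      rw [h] at this
      exact irr _ this
    · have := pre a _ _ h1
      rw [h] at this
      exact irr _ this
  have canR : ∀ {x y z : C} (a b : x ⟶ y) (c : y ⟶ z), a ≫ c = b ≫ c → a = b := by
    intro x y z b c a h
    by_contra hne
    rcases tot b c hne with h1 | h1
    · have := post _ _ a h1
      rw [h] at this
      exact irr _ this
    · have := post _ _ a h1
      rw [h] at this
      exact irr _ this
  have preInv : ∀ {X Y Z : C} (c : X ⟶ Y) (a b : Y ⟶ Z), lt (c ≫ a) (c ≫ b) → lt a b := by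
    intro X Y Z c a b h
    by_cases hab : a = b
    · subst hab; exact absurd h (irr _)
    · rcases tot a b hab with h1 | h1
      · exact h1
      · exact absurd (tra _ _ _ h (pre c _ _ h1)) (irr _)
  have : (⊤ : MorphismProperty C).HasLeftCalculusOfFractions :=
    { exists_leftFraction := by
        intro X Y φ
        obtain ⟨z, b₁, b₂, h⟩ := ore φ.f φ.s
        exact ⟨⟨b₂, b₁, trivial⟩, h⟩
      ext := by
        intro X' X Y f₁ f₂ s _ h
        exact ⟨Y, 𝟙 _, trivial, by rw [canL s f₁ f₂ h]⟩ }
  set Q := (⊤ : MorphismProperty C).Q with hQ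
  have isoQ : ∀ {X Y : C} (f : X ⟶ Y), IsIso (Q.map f) := fun f =>
    Localization.inverts Q (⊤ : MorphismProperty C) f trivial
  have inj : ∀ {X Y : C} (a b : X ⟶ Y), Q.map a = Q.map b → a = b := by
    intro X Y a b h
    obtain ⟨Z, s, _, hs⟩ := (MorphismProperty.map_eq_iff_postcomp Q ⊤ a b).1 h
    exact canR _ _ _ hs
  have frac : ∀ {X Y : C} (g : Q.obj X ⟶ Q.obj Y),
      ∃ (v : C) (a : X ⟶ v) (b : Y ⟶ v), g ≫ Q.map b = Q.map a := by
    intro X Y g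
    obtain ⟨φ, h⟩ := Localization.exists_leftFraction Q ⊤ g
    refine ⟨φ.Y', φ.f, φ.s, ?_⟩
    rw [h]
    exact MorphismProperty.LeftFraction.map_comp_map_s _ _ _
  let Pos : Aut (Q.obj w) → Prop := fun g =>
    ∃ (v : C) (a b : w ⟶ v), lt b a ∧ g.hom ≫ Q.map b = Q.map a
  have pos_one : ¬ Pos 1 := by
    rintro ⟨v, a, b, h, e⟩
    have e' : Q.map b = Q.map a := by
      rw [← e]; exact (Category.id_comp _).symm
    rw [inj _ _ e'] at h
    exact irr _ h
  have pos_mul : ∀ h g, Pos g → Pos h → Pos (h * g) := by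
    rintro h g ⟨v, a, b, l1, e1⟩ ⟨v', c, d, l2, e2⟩
    obtain ⟨z, s, t, hst⟩ := ore b c
    refine ⟨z, a ≫ s, d ≫ t, ?_, ?_⟩
    · refine tra _ (c ≫ t) _ (post _ _ _ l2) ?_
      rw [← hst]; exact post _ _ _ l1
    · change (g.hom ≫ h.hom) ≫ _ = _
      rw [Q.map_comp, Category.assoc, reassoc_of% e2, ← Q.map_comp, ← hst, Q.map_comp,
        reassoc_of% e1, Q.map_comp]
  have pos_conj : ∀ h g, Pos g → Pos (h⁻¹ * g * h) := by
    rintro h g ⟨v, a, b, l1, e1⟩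
    obtain ⟨v', c, d, e2⟩ := frac h.hom
    obtain ⟨z, s, t, hst⟩ := ore d a
    obtain ⟨y, p, q, hpq⟩ := ore (b ≫ t) d
    refine ⟨y, c ≫ s ≫ p, c ≫ q, ?_, ?_⟩
    · apply pre
      apply preInv d
      rw [← hpq, reassoc_of% hst]
      simpa using post _ _ (t ≫ p) l1
    · have e3 : h.inv ≫ Q.map c = Q.map d := by rw [← e2]; exact Iso.inv_hom_id_assoc _ _
      change (h.hom ≫ g.hom ≫ h.inv) ≫ _ = _
      have : (h.hom ≫ g.hom ≫ h.inv) ≫ Q.map (c ≫ q) = h.hom ≫ g.hom ≫ Q.map (d ≫ q) := by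
        simp only [Q.map_comp, Category.assoc, reassoc_of% e3]
      rw [this, ← hpq]
      have : g.hom ≫ Q.map ((b ≫ t) ≫ p) = Q.map (d ≫ s ≫ p) := by
        rw [reassoc_of% hst]
        simp only [Q.map_comp, Category.assoc, reassoc_of% e1]
      rw [this, Q.map_comp, reassoc_of% e2]
      simp only [Q.map_comp]
  have pos_tot : ∀ g, g ≠ 1 → Pos g ∨ Pos g⁻¹ := by
    intro g hg
    obtain ⟨v, a, b, e⟩ := frac g.hom
    have := isoQ b
    by_cases hab : a = b
    · subst hab
      refine absurd ?_ hg
      apply Iso.ext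
      change g.hom = 𝟙 _
      rw [← cancel_mono (Q.map a), e, Category.id_comp]
    · rcases tot a b hab with h | h
      · right
        refine ⟨v, b, a, h, ?_⟩
        change g.inv ≫ _ = _
        rw [← e]; exact Iso.inv_hom_id_assoc _ _
      · left
        exact ⟨v, a, b, h, e⟩
  refine ⟨fun x y => Pos (x⁻¹ * y), ?_, ?_, ?_, ?_, ?_⟩
  · intro a; simpa using pos_one
  · intro a b c h1 h2
    have := pos_mul _ _ h2 h1
    simpa [mul_assoc] using pos_mul _ _ h2 h1
  · intro a b hab
    have : a⁻¹ * b ≠ 1 := fun h => hab (by rw [inv_mul_eq_one] at h; exact h)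
    rcases pos_tot _ this with h | h
    · exact Or.inl h
    · right; simpa using h
  · intro a b c h
    simpa [mul_assoc] using h
  · intro a b c h
    simpa [mul_assoc] using pos_conj a _ h

end General

section Lists

/-- Subdivide the entry at position `i` into `k` equal parts. -/
def step : ℕ → ℕ → List ℚ → List ℚ
  | _, _, [] => []
  | 0, k, l :: r => List.replicate k (l / k) ++ r
  | i + 1, k, l :: r => l :: step i k r

theorem step_append (k : ℕ) (a : List ℚ) (l : ℚ) (b : List ℚ) (i : ℕ) (h : a.length = i) :
    step i k (a ++ l :: b) = a ++ (List.replicate k (l / k) ++ b) := by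
  subst h
  induction a with
  | nil => rfl
  | cons x a ih => simp [step, ih]

theorem step_append_left (k : ℕ) (a b : List ℚ) (i : ℕ) (h : i < a.length) :
    step i k (a ++ b) = step i k a ++ b := by
  induction a generalizing i with
  | nil => simp at h
  | cons x a ih =>
    cases i with
    | zero => simp [step]
    | succ i => simp [step]; exact ih i (by simpa using h)

theorem step_append_right (k : ℕ) (a b : List ℚ) (i j : ℕ) (h : i = a.length + j) :
    step i k (a ++ b) = a ++ step j k b := by
  subst h
  induction a with
  | nil => simp
  | cons x a ih => 
    rw [List.length_cons, show a.length + 1 + j = (a.length + j) + 1 by omega]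
    simp [step, ih]

theorem step_comm (i m k k' : ℕ) (s : List ℚ) :
    step (i + k + m) k' (step i k s) = step i k (step (i + 1 + m) k' s) := by
  induction i generalizing s with
  | zero =>
    cases s with
    | nil => simp [step]
    | cons l r =>
      rw [show 0 + 1 + m = m + 1 by omega]
      simp only [step]
      rw [step_append_right (j := m)]
      simp
  | succ i ih =>
    cases s with
    | nil => simp [step]
    | cons l r =>
      rw [show i + 1 + k + m = (i + k + m) + 1 by omega, show i + 1 + 1 + m = (i + 1 + m) + 1 by omega]
      simp only [step, ih]

theorem step_sum (i k : ℕ) (hk : 2 ≤ k) (s : List ℚ) : (step i k s).sum = s.sum := by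
  induction s generalizing i with
  | nil => simp [step]
  | cons l r ih =>
    cases i with
    | zero =>
      have : (k : ℚ) ≠ 0 := by positivity
      simp [step]; field_simp
    | succ i => simp [step, ih]

theorem step_length (i k : ℕ) (s : List ℚ) (h : i < s.length) :
    (step i k s).length + 1 = s.length + k := by
  induction s generalizing i with
  | nil => simp at h
  | cons l r ih =>
    cases i with
    | zero => simp [step]; omega
    | succ i =>
      have := ih i (by simpa using h)
      simp [step]; omega

/-- All entries are positive. -/
def AllPos (s : List ℚ) : Prop := ∀ x ∈ s, 0 < x

theorem step_pos (i k : ℕ) (hk : 2 ≤ k) (s : List ℚ) (hs : AllPos s) : AllPos (step i k s) := by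
  induction s generalizing i with
  | nil => simpa [step] using hs
  | cons l r ih =>
    have hl : 0 < l := hs l (by simp)
    have hr : AllPos r := fun x hx => hs x (by simp [hx])
    cases i with
    | zero =>
      intro x hx
      simp only [step, List.mem_append, List.mem_replicate] at hx
      rcases hx with ⟨_, rfl⟩ | hx
      · positivity
      · exact hr x hx
    | succ i =>
      intro x hx
      simp only [step, List.mem_cons] at hx
      rcases hx with rfl | hx
      · exact hl
      · exact ih i hr x hx

theorem step_lt (i k : ℕ) (hk : 2 ≤ k) (s t : List ℚ) (h : s < t) : step i k s < step i k t := by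
  obtain ⟨k, rfl⟩ : ∃ k', k = k' + 1 := ⟨k - 1, by omega⟩
  induction s generalizing i t with
  | nil =>
    cases t with
    | nil => exact absurd h (lt_irrefl _)
    | cons b t => cases i <;> simp [step, List.replicate_succ]
  | cons a s ih =>
    cases t with
    | nil => simp at h
    | cons b t =>
      rw [List.cons_lt_cons_iff] at h
      rcases h with h | ⟨rfl, h⟩
      · cases i with
        | zero =>
          simp only [step, List.replicate_succ, List.cons_append]
          rw [List.cons_lt_cons_iff]
          left
          have : (0 : ℚ) < ((k + 1 : ℕ) : ℚ) := by positivity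
          gcongr
        | succ i =>
          simp only [step]
          rw [List.cons_lt_cons_iff]
          exact Or.inl h
      · cases i with
        | zero =>
          simp only [step]
          exact List.append_left_lt h
        | succ i =>
          simp only [step]
          rw [List.cons_lt_cons_iff]
          exact Or.inr ⟨rfl, ih i t h⟩

/-- `x` is a partial sum of `s`. -/
def PSum (s : List ℚ) (x : ℚ) : Prop := ∃ a b, s = a ++ b ∧ a.sum = x

theorem step_psum (i k : ℕ) (hk : 2 ≤ k) (s : List ℚ) (x : ℚ) (h : PSum s x) :
    PSum (step i k s) x := by
  obtain ⟨a, b, rfl, rfl⟩ := h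
  rcases lt_or_ge i a.length with h | h
  · exact ⟨step i k a, b, step_append_left k a b i h, step_sum i k hk a⟩
  · exact ⟨a, step (i - a.length) k b, step_append_right k a b i _ (by omega), rfl⟩

theorem sum_nonneg_of_pos {s : List ℚ} (h : AllPos s) : 0 ≤ s.sum :=
  List.sum_nonneg fun x hx => (h x hx).le

theorem psum_gap (a b : List ℚ) (l x : ℚ) (hp : AllPos (a ++ l :: b)) (h : PSum (a ++ l :: b) x)
    (h1 : a.sum < x) (h2 : x < a.sum + l) : False := by
  obtain ⟨c, d, e, rfl⟩ := h
  rw [List.append_eq_append_iff] at e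
  rcases e with ⟨e, rfl, e2⟩ | ⟨e, rfl, e2⟩
  · cases e with
    | nil => simp at h1
    | cons y e =>
      simp only [List.cons_append, List.cons.injEq] at e2
      obtain ⟨rfl, rfl⟩ := e2
      have : 0 ≤ e.sum := sum_nonneg_of_pos fun x hx => hp x (by simp [hx])
      simp at h2
      linarith
  · have : 0 ≤ e.sum := sum_nonneg_of_pos fun x hx => hp x (by simp [hx])
    simp at h1
    linarith

/-- Concatenation of scaled blocks. -/
def bl : List ℚ → List (List ℚ) → List ℚ
  | l :: ls, c :: cs => c.map (l * ·) ++ bl ls cs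
  | _, _ => []

theorem bl_append (a b : List ℚ) (c d : List (List ℚ)) (h : a.length = c.length) :
    bl (a ++ b) (c ++ d) = bl a c ++ bl b d := by
  induction a generalizing c with
  | nil =>
    cases c with
    | nil => simp [bl]
    | cons => simp at h
  | cons x a ih =>
    cases c with
    | nil => simp at h
    | cons y c => simp [bl, ih c (by simpa using h)]

theorem bl_replicate (k : ℕ) (l : ℚ) (c : List (List ℚ)) (h : c.length = k) (r : ℚ) :
    bl (List.replicate k (l * r)) c = (c.map (List.map (r * ·))).flatten.map (l * ·) := by
  subst h
  induction c with
  | nil => simp [bl]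
  | cons y c ih => simp [bl, List.replicate_succ, ih, mul_assoc]

theorem block_tri (c d : List ℚ) (hc : AllPos c) (hd : AllPos d) (h : c.sum = d.sum) :
    c = d ∨ (∃ s a b t t', c = s ++ a :: t ∧ d = s ++ b :: t' ∧ a < b) ∨
      (∃ s a b t t', d = s ++ a :: t ∧ c = s ++ b :: t' ∧ a < b) := by
  induction c generalizing d with
  | nil =>
    cases d with
    | nil => simp
    | cons y d =>
      have : 0 ≤ d.sum := sum_nonneg_of_pos fun x hx => hd x (by simp [hx])
      have := hd y (by simp)
      simp at h
      linarith
  | cons x c ih =>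
    cases d with
    | nil =>
      have : 0 ≤ c.sum := sum_nonneg_of_pos fun x hx => hc x (by simp [hx])
      have := hc x (by simp)
      simp at h
      linarith
    | cons y d =>
      rcases lt_trichotomy x y with hxy | rfl | hxy
      · exact Or.inr (Or.inl ⟨[], x, y, c, d, rfl, rfl, hxy⟩)
      · rcases ih d (fun x hx => hc x (by simp [hx])) (fun x hx => hd x (by simp [hx]))
          (by simpa using h) with rfl | ⟨s, a, b, t, t', rfl, rfl, hab⟩ |
            ⟨s, a, b, t, t', rfl, rfl, hab⟩
        · exact Or.inl rfl
        · exact Or.inr (Or.inl ⟨x :: s, a, b, t, t', rfl, rfl, hab⟩)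
        · exact Or.inr (Or.inr ⟨x :: s, a, b, t, t', rfl, rfl, hab⟩)
      · exact Or.inr (Or.inr ⟨[], y, x, d, c, rfl, rfl, hxy⟩)

theorem lt_of_diff (l : ℚ) (hl : 0 < l) (s : List ℚ) (a b : ℚ) (t t' X Y : List ℚ) (hab : a < b) :
    (s ++ a :: t).map (l * ·) ++ X < (s ++ b :: t').map (l * ·) ++ Y := by
  simp only [List.map_append, List.map_cons, List.append_assoc, List.cons_append]
  apply List.append_left_lt
  rw [List.cons_lt_cons_iff]
  left
  gcongr

theorem append_lt_cancel (s t t' : List ℚ) (h : s ++ t < s ++ t') : t < t' := by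
  induction s with
  | nil => simpa using h
  | cons x s ih =>
    simp only [List.cons_append, List.cons_lt_cons_iff, lt_irrefl, true_and, false_or] at h
    exact ih h

/-- Good blocks: positive with sum one. -/
def Good (c : List (List ℚ)) : Prop := ∀ s ∈ c, AllPos s ∧ s.sum = 1

theorem bl_lt (l l' : List ℚ) (c d : List (List ℚ)) (hl : AllPos l) (hl' : AllPos l')
    (hc : Good c) (hd : Good d) (h1 : l.length = c.length) (h2 : l'.length = c.length)
    (h3 : d.length = c.length) (h : bl l c < bl l d) : bl l' c < bl l' d := by
  induction c generalizing l l' d with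
  | nil =>
    cases d with
    | nil => exact absurd h (lt_irrefl _)
    | cons => simp at h3
  | cons x c ih =>
    cases d with
    | nil => simp at h3
    | cons y d =>
      cases l with
      | nil => simp at h1
      | cons m l =>
        cases l' with
        | nil => simp at h2
        | cons m' l' =>
          have hm := hl m (by simp)
          have hm' := hl' m' (by simp)
          have hx := hc x (by simp)
          have hy := hd y (by simp)
          simp only [bl] at h ⊢
          rcases block_tri x y hx.1 hy.1 (hx.2.trans hy.2.symm) with rfl |
            ⟨s, a, b, t, t', rfl, rfl, hab⟩ | ⟨s, a, b, t, t', rfl, rfl, hab⟩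
          · apply List.append_left_lt
            exact ih l l' d (fun x hx => hl x (by simp [hx])) (fun x hx => hl' x (by simp [hx]))
              (fun x hx => hc x (by simp [hx])) (fun x hx => hd x (by simp [hx]))
              (by simpa using h1) (by simpa using h2) (by simpa using h3)
              (append_lt_cancel _ _ _ h)
          · exact lt_of_diff m' hm' s a b t t' _ _ hab
          · exact absurd h (not_lt_of_gt (lt_of_diff m hm s a b t t' _ _ hab))

end Lists

section Act

variable {A : Type u} {R : DRS A}

/-- Action of an elementary rewriting on weights. -/
def edgeAct {a b : List A} : DRSEdge R a b → List ℚ → List ℚ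
  | .rewrite w₁ _ _ u _ _ _ => step w₁.length u.length

/-- Action of a path on weights. -/
def pathAct {a : DRSObj R} : {b : DRSObj R} → Quiver.Path a b → List ℚ → List ℚ
  | _, .nil => id
  | _, .cons p e => fun s => edgeAct (R := R) e (pathAct p s)

theorem pathAct_comp {a b c : DRSObj R} (p : Quiver.Path a b) (q : Quiver.Path b c) (s : List ℚ) :
    pathAct (p.comp q) s = pathAct q (pathAct p s) := by
  induction q with
  | nil => rfl
  | cons q e ih =>
    change edgeAct (R := R) e (pathAct (p.comp q) s) = edgeAct (R := R) e _
    rw [ih]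

theorem pathAct_rel {a b : Paths (DRSObj R)} (p q : a ⟶ b) (h : DRSRel R p q) :
    pathAct (R := R) p = pathAct (R := R) q := by
  cases h with
  | comm w₁ w₂ w₃ x₁ x₂ u₁ u₂ h₁ h₂ =>
    funext s
    change step (w₁ ++ u₁ ++ w₂).length u₂.length (step w₁.length u₁.length s) =
      step w₁.length u₁.length (step (w₁ ++ x₁ :: w₂).length u₂.length s)
    have := step_comm w₁.length w₂.length u₁.length u₂.length s
    rw [← show (w₁ ++ u₁ ++ w₂).length = w₁.length + u₁.length + w₂.length by simp; omega,
      ← show (w₁ ++ x₁ :: w₂).length = w₁.length + 1 + w₂.length by simp; omega] at this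
    exact this

/-- Action of a morphism of the category on weights. -/
def act {X Y : DRSCat R} (f : X ⟶ Y) : List ℚ → List ℚ :=
  @Quot.lift (X.as ⟶ Y.as) (@HomRel.CompClosure (Paths (DRSObj R)) _ (DRSRel R) X.as Y.as) _
    (fun p => pathAct (R := R) p) (by
    rintro _ _ ⟨a, b, f, m₁, m₂, g, h⟩
    funext s
    refine (pathAct_comp (R := R) f (m₁ ≫ g) s).trans
      (Eq.trans ?_ (pathAct_comp (R := R) f (m₂ ≫ g) s).symm)
    refine (pathAct_comp (R := R) m₁ g _).trans
      (Eq.trans ?_ (pathAct_comp (R := R) m₂ g _).symm)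
    rw [pathAct_rel m₁ m₂ h]) f

theorem act_comp {X Y Z : DRSCat R} (f : X ⟶ Y) (g : Y ⟶ Z) (s : List ℚ) :
    act (f ≫ g) s = act g (act f s) := by
  rcases f with ⟨f⟩
  rcases g with ⟨g⟩
  exact pathAct_comp (R := R) f g s

theorem act_id (X : DRSCat R) (s : List ℚ) : act (𝟙 X) s = s := rfl

/-- Elementary rewriting as a morphism. -/
def E (w₁ w₂ : List A) (x : A) (u : List A) (hu : R.rule x = some u) {a b : List A}
    (ha : a = w₁ ++ x :: w₂) (hb : b = w₁ ++ u ++ w₂) :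
    DRSCat.ofWord R a ⟶ DRSCat.ofWord R b :=
  (CategoryTheory.Quotient.functor (DRSRel R)).map (singleRewrite R w₁ w₂ x u hu a b ha hb)

theorem act_E (w₁ w₂ : List A) (x : A) (u : List A) (hu : R.rule x = some u) {a b : List A}
    (ha : a = w₁ ++ x :: w₂) (hb : b = w₁ ++ u ++ w₂) (s : List ℚ) :
    act (E w₁ w₂ x u hu ha hb) s = step w₁.length u.length s := rfl

theorem E_comm (w₁ w₂ w₃ : List A) (x₁ x₂ : A) (u₁ u₂ : List A)
    (h₁ : R.rule x₁ = some u₁) (h₂ : R.rule x₂ = some u₂) {a b c d : List A}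
    {y₂ z₁ z₂ y₁ : List A}
    (hy₂ : y₂ = w₂ ++ x₂ :: w₃) (hz₁ : z₁ = w₁ ++ u₁ ++ w₂) (hz₂ : z₂ = w₁ ++ x₁ :: w₂)
    (hy₁ : y₁ = w₂ ++ u₂ ++ w₃)
    (e1 : a = w₁ ++ x₁ :: y₂) (e2 : b = w₁ ++ u₁ ++ y₂)
    (e3 : b = z₁ ++ x₂ :: w₃) (e4 : d = z₁ ++ u₂ ++ w₃)
    (e5 : a = z₂ ++ x₂ :: w₃) (e6 : c = z₂ ++ u₂ ++ w₃)
    (e7 : c = w₁ ++ x₁ :: y₁) (e8 : d = w₁ ++ u₁ ++ y₁) :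
    E w₁ y₂ x₁ u₁ h₁ e1 e2 ≫ E z₁ w₃ x₂ u₂ h₂ e3 e4 =
      E z₂ w₃ x₂ u₂ h₂ e5 e6 ≫ E w₁ y₁ x₁ u₁ h₁ e7 e8 := by
  subst hy₂ hz₁ hz₂ hy₁ e1 e2 e7 e8
  exact CategoryTheory.Quotient.sound (DRSRel R) (DRSRel.comm w₁ w₂ w₃ x₁ x₂ u₁ u₂ h₁ h₂)

theorem ind_tail {a : List A} (P : ∀ {b : List A}, (DRSCat.ofWord R a ⟶ DRSCat.ofWord R b) → Prop)
    (h0 : P (𝟙 _))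
    (h1 : ∀ {b c : List A} (f : DRSCat.ofWord R a ⟶ DRSCat.ofWord R b) (w₁ w₂ : List A) (x : A)
      (u : List A) (hu : R.rule x = some u) (hb : b = w₁ ++ x :: w₂) (hc : c = w₁ ++ u ++ w₂),
      P f → P (f ≫ E w₁ w₂ x u hu hb hc))
    {b : List A} (f : DRSCat.ofWord R a ⟶ DRSCat.ofWord R b) : P f := by
  rcases f with ⟨p⟩
  change Quiver.Path (⟨a⟩ : DRSObj R) ⟨b⟩ at p
  have key : ∀ (b : DRSObj R) (p : Quiver.Path (⟨a⟩ : DRSObj R) b),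
      P (b := b.word) ((CategoryTheory.Quotient.functor (DRSRel R)).map p) := by
    intro b p
    induction p with
    | nil => exact h0
    | cons p e ih =>
      rcases e with ⟨w₁, w₂, x, u, hu, ha, hb⟩
      exact h1 _ w₁ w₂ x u hu ha hb ih
  exact key ⟨b⟩ p

theorem ind_head {b : List A} (P : ∀ {a : List A}, (DRSCat.ofWord R a ⟶ DRSCat.ofWord R b) → Prop)
    (h0 : P (𝟙 _))
    (h1 : ∀ {a c : List A} (f : DRSCat.ofWord R c ⟶ DRSCat.ofWord R b) (w₁ w₂ : List A) (x : A)
      (u : List A) (hu : R.rule x = some u) (ha : a = w₁ ++ x :: w₂) (hc : c = w₁ ++ u ++ w₂),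
      P f → P (E w₁ w₂ x u hu ha hc ≫ f))
    {a : List A} (f : DRSCat.ofWord R a ⟶ DRSCat.ofWord R b) : P f := by
  have key : ∀ {c : List A} (g : DRSCat.ofWord R a ⟶ DRSCat.ofWord R c)
      (f : DRSCat.ofWord R c ⟶ DRSCat.ofWord R b), P f → P (g ≫ f) := by
    intro c g
    refine ind_tail (P := fun {c} g => ∀ (f : DRSCat.ofWord R c ⟶ DRSCat.ofWord R b),
      P f → P (g ≫ f)) ?_ ?_ g
    · intro f hf
      rw [Category.id_comp]; exact hf
    · intro b c f w₁ w₂ x u hu hb hc ih g hg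
      rw [Category.assoc]
      exact ih _ (h1 g w₁ w₂ x u hu hb hc hg)
  have := key f (𝟙 _) h0
  rwa [Category.comp_id] at this

variable {a b c : List A}

theorem act_pos (f : DRSCat.ofWord R a ⟶ DRSCat.ofWord R b) (s : List ℚ) (hs : AllPos s) :
    AllPos (act f s) := by
  refine ind_tail (P := fun f => AllPos (act f s)) ?_ ?_ f
  · exact hs
  intro b c f w₁ w₂ x u hu hb hc ih
  rw [act_comp, act_E]
  exact step_pos _ _ (R.two_le_length x u hu) _ ih

theorem act_psum (f : DRSCat.ofWord R a ⟶ DRSCat.ofWord R b) (s : List ℚ) (y : ℚ)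
    (hs : PSum s y) : PSum (act f s) y := by
  refine ind_tail (P := fun f => PSum (act f s) y) ?_ ?_ f
  · exact hs
  intro b c f w₁ w₂ x u hu hb hc ih
  rw [act_comp, act_E]
  exact step_psum _ _ (R.two_le_length x u hu) _ _ ih

theorem act_length (f : DRSCat.ofWord R a ⟶ DRSCat.ofWord R b) (s : List ℚ)
    (hs : s.length = a.length) : (act f s).length = b.length := by
  refine ind_tail (P := fun {b} f => (act f s).length = b.length) ?_ ?_ f
  · exact hs
  intro b c f w₁ w₂ x u hu hb hc ih
  rw [act_comp, act_E]
  subst hb hc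
  have := step_length w₁.length u.length (act f s) (by rw [ih]; simp)
  rw [ih] at this
  simp at this ⊢
  omega

theorem act_lt (f : DRSCat.ofWord R a ⟶ DRSCat.ofWord R b) (s t : List ℚ) (h : s < t) :
    act f s < act f t := by
  refine ind_tail (P := fun f => act f s < act f t) ?_ ?_ f
  · exact h
  intro b c f w₁ w₂ x u hu hb hc ih
  rw [act_comp, act_comp, act_E, act_E]
  exact step_lt _ _ (R.two_le_length x u hu) _ _ ih

theorem len_le (f : DRSCat.ofWord R a ⟶ DRSCat.ofWord R b) : a.length ≤ b.length := by
  refine ind_tail (P := fun {b} f => a.length ≤ b.length) le_rfl ?_ f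
  intro b c f w₁ w₂ x u hu hb hc ih
  have := R.two_le_length x u hu
  subst hb hc
  simp at ih ⊢
  omega

theorem endo_eq_id (f : DRSCat.ofWord R a ⟶ DRSCat.ofWord R a) : f = 𝟙 _ := by
  have key : a.length < a.length ∨ ∃ h : a = a, f = eqToHom (by rw [h]) := by
    refine ind_tail (P := fun {b} f => a.length < b.length ∨ ∃ h : a = b, f = eqToHom (by rw [h]))
      (Or.inr ⟨rfl, rfl⟩) ?_ f
    intro b c f w₁ w₂ x u hu hb hc _
    left
    have := len_le f
    have := R.two_le_length x u hu
    subst hb hc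
    simp at this ⊢
    simp at *
    omega
  rcases key with h | ⟨_, h⟩
  · omega
  · exact h

theorem act_blocks (f : DRSCat.ofWord R a ⟶ DRSCat.ofWord R b) :
    ∃ C : List (List ℚ), C.length = a.length ∧ Good C ∧
      ∀ s : List ℚ, s.length = a.length → act f s = bl s C := by
  refine ind_head (P := fun {a} f => ∃ C : List (List ℚ), C.length = a.length ∧ Good C ∧
      ∀ s : List ℚ, s.length = a.length → act f s = bl s C) ?_ ?_ f
  · refine ⟨List.replicate b.length [1], by simp, ?_, ?_⟩
    · intro s hs
      obtain ⟨_, rfl⟩ := List.mem_replicate.1 hs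
      simp [AllPos]
    · intro s hs
      rw [act_id, ← hs]
      clear hs
      induction s with
      | nil => rfl
      | cons l s ih => simpa [bl, List.replicate_succ] using ih
  · intro a c f w₁ w₂ x u hu ha hc ⟨C, hC, hg, hact⟩
    have hk := R.two_le_length x u hu
    subst ha hc
    obtain ⟨C₁, C', rfl, hC₁⟩ : ∃ C₁ C', C = C₁ ++ C' ∧ C₁.length = w₁.length :=
      ⟨C.take w₁.length, C.drop w₁.length, by simp, by simp at hC ⊢; omega⟩
    obtain ⟨C₂, C₃, rfl, hC₂⟩ : ∃ C₂ C₃, C' = C₂ ++ C₃ ∧ C₂.length = u.length :=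
      ⟨C'.take u.length, C'.drop u.length, by simp, by simp at hC ⊢; omega⟩
    have hC₃ : C₃.length = w₂.length := by simp at hC; omega
    refine ⟨C₁ ++ (C₂.map (List.map ((u.length : ℚ)⁻¹ * ·))).flatten :: C₃, by simp; omega, ?_, ?_⟩
    · intro s hs
      simp only [List.mem_append, List.mem_cons] at hs
      rcases hs with hs | rfl | hs
      · exact hg s (by simp [hs])
      · have hg2 : Good C₂ := fun s hs => hg s (by simp [hs])
        constructor
        · intro y hy
          simp only [List.mem_flatten, List.mem_map] at hy
          obtain ⟨_, ⟨t, ht, rfl⟩, hy⟩ := hy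
          obtain ⟨z, hz, rfl⟩ := List.mem_map.1 hy
          have := (hg2 t ht).1 z hz
          positivity
        · have hne : (u.length : ℚ) ≠ 0 := by positivity
          have : ∀ (r : ℚ) (D : List (List ℚ)), Good D →
              (D.map (List.map (r * ·))).flatten.sum = D.length * r := by
            intro r D hD
            induction D with
            | nil => simp
            | cons d D ih =>
              have := ih fun s hs => hD s (by simp [hs])
              have h1 := (hD d (by simp)).2
              have h2 : (d.map (r * ·)).sum = r * d.sum := by
                simpa using List.sum_map_mul_left d id r
              simp only [List.map_cons, List.flatten_cons, List.sum_append, this,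
                h2, h1, List.length_cons]
              push_cast; ring
          rw [this _ _ hg2, hC₂]
          field_simp
      · exact hg s (by simp [hs])
    · intro s hs
      obtain ⟨s₁, l, s₂, rfl, h1⟩ : ∃ s₁ l s₂, s = s₁ ++ l :: s₂ ∧ s₁.length = w₁.length := by
        have hlt : w₁.length < s.length := by rw [hs]; simp
        exact ⟨s.take w₁.length, s[w₁.length], s.drop (w₁.length + 1), by simp, by simp; omega⟩
      have h2 : s₂.length = w₂.length := by simp at hs; omega
      rw [act_comp, act_E, step_append _ _ _ _ _ h1, hact _ (by simp; omega),
        bl_append _ _ _ _ (by omega), bl_append _ _ _ _ (by simp; omega),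
        bl_append _ _ _ _ (by omega),
        div_eq_mul_inv, bl_replicate _ _ _ hC₂]
      rfl

theorem act_lt_indep (f g : DRSCat.ofWord R a ⟶ DRSCat.ofWord R b) (s t : List ℚ)
    (hs : s.length = a.length) (ht : t.length = a.length) (ps : AllPos s) (pt : AllPos t)
    (h : act f s < act g s) : act f t < act g t := by
  obtain ⟨C, hC, gC, eC⟩ := act_blocks f
  obtain ⟨D, hD, gD, eD⟩ := act_blocks g
  rw [eC s hs, eD s hs] at h
  rw [eC t ht, eD t ht]
  exact bl_lt s t C D ps pt gC gD (by omega) (by omega) (by omega) h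

theorem append_cons_cases {v₁ v₂ z₁ z₂ : List A} {x y : A} (h : v₁ ++ x :: v₂ = z₁ ++ y :: z₂) :
    (v₁ = z₁ ∧ x = y ∧ v₂ = z₂) ∨ (∃ m, z₁ = v₁ ++ x :: m ∧ v₂ = m ++ y :: z₂) ∨
      (∃ m, v₁ = z₁ ++ y :: m ∧ z₂ = m ++ x :: v₂) := by
  rw [List.append_eq_append_iff] at h
  rcases h with ⟨e, rfl, h⟩ | ⟨e, rfl, h⟩
  · cases e with
    | nil => simp at h; simp [h]
    | cons q e =>
      simp only [List.cons_append, List.cons.injEq] at h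
      obtain ⟨rfl, rfl⟩ := h
      exact Or.inr (Or.inl ⟨e, rfl, rfl⟩)
  · cases e with
    | nil => simp at h; simp [h]
    | cons q e =>
      simp only [List.cons_append, List.cons.injEq] at h
      obtain ⟨rfl, rfl⟩ := h
      exact Or.inr (Or.inr ⟨e, rfl, rfl⟩)

/-- Either `q` factors through the given elementary rewriting, or it leaves the letter `x` alone. -/
theorem factor (w₁ w₂ : List A) (x : A) (u : List A) (hu : R.rule x = some u) {a c : List A}
    (ha : a = w₁ ++ x :: w₂) (hc : c = w₁ ++ u ++ w₂) {b : List A}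
    (q : DRSCat.ofWord R a ⟶ DRSCat.ofWord R b) :
    (∃ q' : DRSCat.ofWord R c ⟶ DRSCat.ofWord R b, q = E w₁ w₂ x u hu ha hc ≫ q') ∨
    (∃ (v₁ v₂ : List A) (hb : b = v₁ ++ x :: v₂)
      (q' : DRSCat.ofWord R c ⟶ DRSCat.ofWord R (v₁ ++ u ++ v₂)),
      q ≫ E v₁ v₂ x u hu hb rfl = E w₁ w₂ x u hu ha hc ≫ q' ∧
      ∀ (s₁ : List ℚ) (l : ℚ) (s₂ : List ℚ), s₁.length = w₁.length → 
        ∃ m₁ m₂ : List ℚ, m₁.length = v₁.length ∧ m₁.sum = s₁.sum ∧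
          act q (s₁ ++ l :: s₂) = m₁ ++ l :: m₂) := by
  refine ind_tail (P := fun {b} q =>
    (∃ q' : DRSCat.ofWord R c ⟶ DRSCat.ofWord R b, q = E w₁ w₂ x u hu ha hc ≫ q') ∨
    (∃ (v₁ v₂ : List A) (hb : b = v₁ ++ x :: v₂)
      (q' : DRSCat.ofWord R c ⟶ DRSCat.ofWord R (v₁ ++ u ++ v₂)),
      q ≫ E v₁ v₂ x u hu hb rfl = E w₁ w₂ x u hu ha hc ≫ q' ∧
      ∀ (s₁ : List ℚ) (l : ℚ) (s₂ : List ℚ), s₁.length = w₁.length → 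
        ∃ m₁ m₂ : List ℚ, m₁.length = v₁.length ∧ m₁.sum = s₁.sum ∧
          act q (s₁ ++ l :: s₂) = m₁ ++ l :: m₂)) ?_ ?_ q
  · right
    subst hc
    refine ⟨w₁, w₂, ha, 𝟙 _, by rw [Category.id_comp, Category.comp_id], ?_⟩
    intro s₁ l s₂ h1
    exact ⟨s₁, s₂, h1, rfl, rfl⟩
  · intro b d q z₁ z₂ y t ht hb hd ih
    rcases ih with ⟨q', rfl⟩ | ⟨v₁, v₂, hb', q', hq, hact⟩
    · exact Or.inl ⟨q' ≫ E z₁ z₂ y t ht hb hd, by rw [Category.assoc]⟩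
    · have hk := R.two_le_length y t ht
      have hcases := append_cons_cases (hb'.symm.trans hb)
      rcases hcases with ⟨rfl, rfl, rfl⟩ | ⟨m, rfl, rfl⟩ | ⟨m, rfl, rfl⟩
      · left
        obtain rfl : u = t := by rw [hu] at ht; exact Option.some.inj ht
        subst hd
        exact ⟨q', hq⟩
      · right
        refine ⟨v₁, m ++ t ++ z₂, by rw [hd]; simp,
          q' ≫ E (v₁ ++ u ++ m) z₂ y t ht (by simp) (by simp), ?_, ?_⟩
        · rw [Category.assoc, ← E_comm v₁ m z₂ x y u t hu ht rfl rfl rfl rfl hb' rfl, reassoc_of% hq]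
        · intro s₁ l s₂ h1
          obtain ⟨m₁, m₂, e1, e2, e3⟩ := hact s₁ l s₂ h1
          refine ⟨m₁, step m.length t.length m₂, e1, e2, ?_⟩
          rw [act_comp, act_E, e3, step_append_right (j := m.length + 1)]
          · rfl
          · simp [e1]
      · right
        refine ⟨z₁ ++ t ++ m, v₂, by rw [hd]; simp,
          q' ≫ E z₁ (m ++ u ++ v₂) y t ht (by simp) (by simp), ?_, ?_⟩
        · rw [Category.assoc, E_comm z₁ m v₂ y x t u ht hu rfl rfl rfl rfl (c := z₁ ++ y :: m ++ u ++ v₂)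
            (e5 := hb') (e6 := rfl) (e7 := by simp) (e8 := by simp), reassoc_of% hq]
        · intro s₁ l s₂ h1
          obtain ⟨m₁, m₂, e1, e2, e3⟩ := hact s₁ l s₂ h1
          have hlt : z₁.length < m₁.length := by rw [e1]; simp
          refine ⟨step z₁.length t.length m₁, m₂, ?_, ?_, ?_⟩
          · have := step_length z₁.length t.length m₁ hlt
            rw [e1] at this
            simp at this ⊢
            omega
          · rw [step_sum _ _ hk, e2]
          · rw [act_comp, act_E, e3, step_append_left _ _ _ _ hlt]

theorem ore_word {b₁ b₂ : List A} (p : DRSCat.ofWord R a ⟶ DRSCat.ofWord R b₁)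
    (q : DRSCat.ofWord R a ⟶ DRSCat.ofWord R b₂) :
    ∃ (d : List A) (s : DRSCat.ofWord R b₁ ⟶ DRSCat.ofWord R d)
      (t : DRSCat.ofWord R b₂ ⟶ DRSCat.ofWord R d), p ≫ s = q ≫ t := by
  refine ind_tail (P := fun {b₁} p => ∃ (d : List A) (s : DRSCat.ofWord R b₁ ⟶ DRSCat.ofWord R d)
      (t : DRSCat.ofWord R b₂ ⟶ DRSCat.ofWord R d), p ≫ s = q ≫ t) ?_ ?_ p
  · exact ⟨b₂, q, 𝟙 _, by simp⟩
  · intro b c p w₁ w₂ x u hu hb hc ⟨d, s, t, hst⟩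
    rcases factor w₁ w₂ x u hu hb hc s with ⟨s', rfl⟩ | ⟨v₁, v₂, hd, s', hs, _⟩
    · exact ⟨d, s', t, by rw [Category.assoc]; exact hst⟩
    · refine ⟨_, s', t ≫ E v₁ v₂ x u hu hd rfl, ?_⟩
      rw [Category.assoc, ← hs, reassoc_of% hst]

theorem faithful (f g : DRSCat.ofWord R a ⟶ DRSCat.ofWord R b) (s : List ℚ)
    (hs : s.length = a.length) (ps : AllPos s) (h : act f s = act g s) : f = g := by
  revert g s
  refine ind_head (P := fun {a} f => ∀ (g : DRSCat.ofWord R a ⟶ DRSCat.ofWord R b) (s : List ℚ),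
    s.length = a.length → AllPos s → act f s = act g s → f = g) ?_ ?_ f
  · intro g s _ _ _
    exact (endo_eq_id g).symm
  · intro a c f w₁ w₂ x u hu ha hc ih g s hs ps h
    have hk := R.two_le_length x u hu
    have hlt : w₁.length < s.length := by rw [hs, ha]; simp
    rcases factor w₁ w₂ x u hu ha hc g with ⟨g', rfl⟩ | ⟨v₁, v₂, hd, g', hg, hact⟩
    · rw [act_comp, act_comp] at h
      rw [ih g' _ (act_length _ s hs) (act_pos _ s ps) h]
    · exfalso
      obtain ⟨s₁, l, s₂, rfl, h1⟩ : ∃ s₁ l s₂, s = s₁ ++ l :: s₂ ∧ s₁.length = w₁.length :=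
        ⟨s.take w₁.length, s[w₁.length], s.drop (w₁.length + 1), by simp, by simp; omega⟩
      obtain ⟨m₁, m₂, e1, e2, e3⟩ := hact s₁ l s₂ h1
      have hl : 0 < l := ps l (by simp)
      have hp : PSum (act (E w₁ w₂ x u hu ha hc ≫ f) (s₁ ++ l :: s₂)) (s₁.sum + l / u.length) := by
        rw [act_comp]
        apply act_psum
        rw [act_E, step_append _ _ _ _ _ h1]
        obtain ⟨k, hk'⟩ : ∃ k, u.length = k + 1 := ⟨u.length - 1, by omega⟩
        refine ⟨s₁ ++ [l / u.length], List.replicate k (l / u.length) ++ s₂, ?_, by simp⟩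
        rw [hk', List.replicate_succ]
        simp
      have hpos := act_pos g _ ps
      rw [h, e3] at hp
      rw [e3] at hpos
      have hk2 : (2 : ℚ) ≤ u.length := by exact_mod_cast hk
      refine psum_gap m₁ m₂ l _ hpos hp ?_ ?_
      · rw [e2]
        have : 0 < l / u.length := by positivity
        linarith
      · rw [e2]
        have : l / u.length < l := by
          rw [div_lt_iff₀ (by linarith)]
          nlinarith
        linarith

/-- Unit weights. -/
def ones (X : DRSCat R) : List ℚ := List.replicate X.as.word.length 1

theorem ones_length (X : DRSCat R) : (ones X).length = X.as.word.length := by simp [ones]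

theorem ones_pos (X : DRSCat R) : AllPos (ones X) := by
  intro x hx
  obtain ⟨_, rfl⟩ := List.mem_replicate.1 hx
  exact one_pos

end Act

/-- **Diagram groups of DRSs are bi-orderable.**  For every digit rewriting system with
associated category `F` and every finite word `w` over its alphabet, the fundamental group
`Π(F, w)` is bi-orderable. -/
theorem drs_fundamental_group_biOrderable {A : Type u} (R : DRS A) (w : List A) :
    IsBiOrderable (FundGroup (DRSCat R) (DRSCat.ofWord R w)) := by
  refine biOrderable_of_order (C := DRSCat R)
    (fun {X Y} f g => act f (ones X) < act g (ones X)) ?_ ?_ ?_ ?_ ?_ ?_ _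
  · intro X Y a
    exact lt_irrefl _
  · intro X Y a b c
    exact lt_trans
  · intro X Y a b hab
    apply lt_or_gt_of_ne
    intro h
    exact hab (faithful (a := X.as.word) (b := Y.as.word) a b _ (ones_length X) (ones_pos X) h)
  · intro X Y Z a b c h
    rw [act_comp, act_comp]
    exact act_lt (a := Y.as.word) (b := Z.as.word) c _ _ h
  · intro X Y Z c a b h
    rw [act_comp, act_comp]
    exact act_lt_indep (a := Y.as.word) (b := Z.as.word) a b _ _ (ones_length Y)
      (act_length (a := X.as.word) (b := Y.as.word) c _ (ones_length X)) (ones_pos Y)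
      (act_pos (a := X.as.word) (b := Y.as.word) c _ (ones_pos X)) h
  · intro x y₁ y₂ p q
    obtain ⟨d, s, t, h⟩ := ore_word (a := x.as.word) (b₁ := y₁.as.word) (b₂ := y₂.as.word) p q
    exact ⟨_, s, t, h⟩

end OreOrder
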